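/- arXiv:1404.4987 — 2 statements merged into one kernel-verified Lean document; each statement's English description precedes it below -/
import Mathlib

section
/- For every real c > 2.774 and every real β with 0.999971 < β ≤ 1, with high probability as n → ∞ the random graph G_{n,c/n} contains no induced bipartite subgraph on ⌈βn⌉ or more vertices. -/
open Filter SimpleGraph

open scoped Classical in
/-- The probability, under the Erdős–Rényi random graph `G_{n,p}` on vertex set `Fin n`
(each of the `n.choose 2` potential edges present independently with probability `p`),
that the random graph satisfies the property `P`. -/
noncomputable def erProb (n : ℕ) (p : ℝ) (P : SimpleGraph (Fin n) → Prop) : ℝ :=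
  ∑ G : SimpleGraph (Fin n),
    if P G then p ^ G.edgeSet.ncard * (1 - p) ^ (n.choose 2 - G.edgeSet.ncard) else 0

open scoped Classical in
/-- Probability that all pairs of `F` are non-edges. -/
lemma erProb_avoid (n : ℕ) (p : ℝ) (F : Finset (Sym2 (Fin n)))
    (hF : F ⊆ (⊤ : SimpleGraph (Fin n)).edgeFinset) :
    erProb n p (fun G => ∀ e ∈ F, e ∉ G.edgeSet) = (1 - p) ^ F.card := by
  have hE : (⊤ : SimpleGraph (Fin n)).edgeFinset.card = n.choose 2 := by
    rw [SimpleGraph.card_edgeFinset_top_eq_card_choose_two, Fintype.card_fin]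
  have hcard : ((⊤ : SimpleGraph (Fin n)).edgeFinset \ F).card + F.card = n.choose 2 := by
    rw [← hE, Finset.card_sdiff_add_card_eq_card hF]
  unfold erProb
  refine Eq.trans (b := ∑ G ∈ Finset.univ.filter
    (fun G : SimpleGraph (Fin n) => ∀ e ∈ F, e ∉ G.edgeSet),
    p ^ G.edgeSet.ncard * (1 - p) ^ (n.choose 2 - G.edgeSet.ncard)) ?_ ?_
  · rw [Finset.sum_filter]
    exact Finset.sum_congr rfl fun G _ => by congr
  have key : ∑ t ∈ ((⊤ : SimpleGraph (Fin n)).edgeFinset \ F).powerset,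
      p ^ t.card * (1 - p) ^ (((⊤ : SimpleGraph (Fin n)).edgeFinset \ F).card - t.card) = 1 := by
    rw [Finset.sum_pow_mul_eq_add_pow]; simp
  have key2 := congrArg (fun x => x * (1 - p) ^ F.card) key
  simp only [one_mul, Finset.sum_mul] at key2
  rw [← key2]
  refine Finset.sum_bij' (fun G _ => G.edgeFinset) (fun t _ => SimpleGraph.fromEdgeSet (t : Set _))
    ?_ ?_ ?_ ?_ ?_
  · intro G hG
    simp only [Finset.mem_filter, Finset.mem_univ, true_and] at hG
    rw [Finset.mem_powerset]
    intro e he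
    rw [Finset.mem_sdiff]
    refine ⟨SimpleGraph.edgeFinset_mono le_top he, fun h => hG e h ?_⟩
    simpa using he
  · intro t ht
    simp only [Finset.mem_filter, Finset.mem_univ, true_and]
    intro e he h
    rw [SimpleGraph.edgeSet_fromEdgeSet] at h
    exact (Finset.mem_sdiff.1 (Finset.mem_powerset.1 ht h.1)).2 he
  · intro G hG
    simp
  · intro t ht
    ext e
    simp only [SimpleGraph.mem_edgeFinset, SimpleGraph.edgeSet_fromEdgeSet]
    constructor
    · intro h; exact h.1
    · intro h
      refine ⟨h, ?_⟩
      have := (Finset.mem_sdiff.1 (Finset.mem_powerset.1 ht h)).1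
      simpa using this
  · intro G hG
    simp only [Finset.mem_filter, Finset.mem_univ, true_and] at hG
    have hsub : G.edgeFinset ⊆ (⊤ : SimpleGraph (Fin n)).edgeFinset \ F := by
      intro e he
      rw [Finset.mem_sdiff]
      refine ⟨SimpleGraph.edgeFinset_mono le_top he, fun h => hG e h ?_⟩
      simpa using he
    have hle := Finset.card_le_card hsub
    have h1 : G.edgeSet.ncard = G.edgeFinset.card := by
      rw [← SimpleGraph.coe_edgeFinset, Set.ncard_coe_finset]
    rw [h1, mul_assoc, ← pow_add]
    congr 2
    omega

lemma erProb_add_not (n : ℕ) (p : ℝ) (P : SimpleGraph (Fin n) → Prop) :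
    erProb n p P = 1 - erProb n p (fun G => ¬ P G) := by
  classical
  have h := erProb_avoid n p ∅ (by simp)
  simp only [Finset.card_empty, pow_zero] at h
  rw [← h, eq_sub_iff_add_eq]
  unfold erProb
  rw [← Finset.sum_add_distrib]
  refine Finset.sum_congr rfl fun G _ => ?_
  by_cases hP : P G <;> simp [hP]

lemma erProb_nonneg (n : ℕ) (p : ℝ) (h0 : 0 ≤ p) (h1 : p ≤ 1) (P : SimpleGraph (Fin n) → Prop) :
    0 ≤ erProb n p P := by
  classical
  unfold erProb
  refine Finset.sum_nonneg fun G _ => ?_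
  have : 0 ≤ 1 - p := by linarith
  split_ifs <;> positivity

lemma erProb_union {ι : Type*} (s : Finset ι) (n : ℕ) (p : ℝ) (h0 : 0 ≤ p) (h1 : p ≤ 1)
    (P : SimpleGraph (Fin n) → Prop) (Q : ι → SimpleGraph (Fin n) → Prop)
    (h : ∀ G, P G → ∃ i ∈ s, Q i G) :
    erProb n p P ≤ ∑ i ∈ s, erProb n p (Q i) := by
  classical
  unfold erProb
  rw [Finset.sum_comm]
  refine Finset.sum_le_sum fun G _ => ?_
  have h2 : 0 ≤ 1 - p := by linarith
  have hnn : ∀ i ∈ s, 0 ≤ if Q i G then p ^ G.edgeSet.ncard *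
      (1 - p) ^ (n.choose 2 - G.edgeSet.ncard) else 0 := by
    intro i _
    split_ifs <;> positivity
  by_cases hP : P G
  · obtain ⟨i, hi, hQ⟩ := h G hP
    refine le_trans ?_ (Finset.single_le_sum hnn hi)
    simp [hP, hQ]
  · simp only [hP, if_false]
    exact Finset.sum_nonneg hnn

/-- The monochromatic pairs of a partial 2-colouring (`none` = removed). -/
def monoPairs (n : ℕ) (f : Fin n → Option Bool) : Finset (Sym2 (Fin n)) :=
  (Finset.univ.filter (fun v => f v = some true)).offDiag.image (Function.uncurry Sym2.mk) ∪
  (Finset.univ.filter (fun v => f v = some false)).offDiag.image (Function.uncurry Sym2.mk)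

/-- The number of removed vertices. -/
def removed (n : ℕ) (f : Fin n → Option Bool) : ℕ :=
  (Finset.univ.filter (fun v => f v = none)).card

lemma monoPairs_card (n : ℕ) (f : Fin n → Option Bool) :
    ((n : ℝ) - removed n f) ^ 2 / 4 - (n : ℝ) / 2 ≤ (monoPairs n f).card := by
  have hsum : (Finset.univ.filter (fun v => f v = some true)).card +
      (Finset.univ.filter (fun v => f v = some false)).card + removed n f = n := by
    have h := Finset.card_eq_sum_card_fiberwise (f := f) (s := Finset.univ) (t := Finset.univ)
      (by simp)
    simp only [Finset.card_univ, Fintype.card_fin] at h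
    rw [Fintype.sum_option, Fintype.sum_bool] at h
    unfold removed
    omega
  unfold monoPairs
  rw [Finset.card_union_of_disjoint, Sym2.card_image_offDiag, Sym2.card_image_offDiag]
  · generalize (Finset.univ.filter (fun v => f v = some true)).card = a at *
    generalize (Finset.univ.filter (fun v => f v = some false)).card = b at *
    generalize removed n f = r at *
    subst hsum
    push_cast
    rw [Nat.cast_choose_two, Nat.cast_choose_two]
    have : (0 : ℝ) ≤ r := by positivity
    nlinarith [sq_nonneg ((a : ℝ) - b)]
  · rw [Finset.disjoint_left]
    intro e he he'
    simp only [Finset.mem_image, Finset.mem_offDiag, Finset.mem_filter, Finset.mem_univ, true_and,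
      Prod.exists, Function.uncurry_apply_pair] at he he'
    obtain ⟨a, b, ⟨h1, h2, _⟩, rfl⟩ := he
    obtain ⟨a', b', ⟨h1', h2', _⟩, h⟩ := he'
    rw [Sym2.eq_iff] at h
    rcases h with ⟨rfl, rfl⟩ | ⟨rfl, rfl⟩ <;> simp_all

lemma monoPairs_sub (n : ℕ) (f : Fin n → Option Bool) :
    ∀ e ∈ monoPairs n f, ∃ u v, u ≠ v ∧ f u ≠ none ∧ f u = f v ∧ e = s(u, v) := by
  intro e he
  simp only [monoPairs, Finset.mem_union, Finset.mem_image, Finset.mem_offDiag, Finset.mem_filter,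
    Finset.mem_univ, true_and, Prod.exists, Function.uncurry_apply_pair] at he
  rcases he with ⟨a, b, ⟨h1, h2, h3⟩, rfl⟩ | ⟨a, b, ⟨h1, h2, h3⟩, rfl⟩
  · exact ⟨a, b, h3, by simp [h1], by simp [h1, h2], rfl⟩
  · exact ⟨a, b, h3, by simp [h1], by simp [h1, h2], rfl⟩

lemma sum_removed (n : ℕ) (t : ℝ) :
    ∑ f : Fin n → Option Bool, t ^ removed n f = (2 + t) ^ n := by
  have h1 : ∀ f : Fin n → Option Bool,
      t ^ removed n f = ∏ i, (if f i = none then t else 1) := by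
    intro f
    rw [Finset.prod_ite]
    simp [removed]
  simp only [h1]
  have h := Finset.prod_univ_sum (fun _ : Fin n => (Finset.univ : Finset (Option Bool)))
    (fun _ j => if j = none then t else (1 : ℝ))
  rw [Fintype.piFinset_univ] at h
  rw [← h]
  simp only [Fintype.sum_option, Fintype.sum_bool]
  simp
  congr 1
  ring

lemma exists_coloring (n m : ℕ) (G : SimpleGraph (Fin n)) (S : Finset (Fin n)) (hS : m ≤ S.card)
    (hG : (G.induce (S : Set (Fin n))).Colorable 2) :
    ∃ f : Fin n → Option Bool, removed n f + m ≤ n ∧ ∀ e ∈ monoPairs n f, e ∉ G.edgeSet := by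
  classical
  obtain ⟨C⟩ := hG
  let f : Fin n → Option Bool := fun v =>
    if h : v ∈ S then some (decide (C ⟨v, h⟩ = 0)) else none
  refine ⟨f, ?_, ?_⟩
  · have : removed n f = Sᶜ.card := by
      unfold removed
      congr 1
      ext v
      simp [f]
    rw [this, Finset.card_compl, Fintype.card_fin]
    have := Finset.card_le_univ S
    rw [Fintype.card_fin] at this
    omega
  · intro e he hadj
    obtain ⟨u, v, huv, hn, hf, rfl⟩ := monoPairs_sub n f e he
    rw [SimpleGraph.mem_edgeSet] at hadj
    by_cases hu : u ∈ S
    · by_cases hv : v ∈ S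
      · have hne : C ⟨u, hu⟩ ≠ C ⟨v, hv⟩ := C.valid (by simpa using hadj)
        simp only [f, hu, hv, dif_pos, Option.some.injEq, decide_eq_decide] at hf
        omega
      · simp [f, hu, hv] at hf
    · simp [f, hu] at hn

lemma rate_neg (c β : ℝ) (hc : 2.774 < c) (hβ0 : 0.999971 < β) :
    Real.log (2 + 0.000058) - 0.000029 * Real.log 0.000058 - c * β ^ 2 / 4 < 0 := by
  have h2 := Real.log_two_lt_d9
  have e1 : Real.log (2 + 0.000058) ≤ Real.log 2 + 0.000029 := by
    have : (2 + 0.000058 : ℝ) = 2 * 1.000029 := by norm_num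
    rw [this, Real.log_mul (by norm_num) (by norm_num)]
    have := Real.log_le_sub_one_of_pos (show (0 : ℝ) < 1.000029 by norm_num)
    norm_num at this ⊢
    linarith
  have e2 : -9.757 ≤ Real.log 0.000058 := by
    have : (0.000058 : ℝ) = (2 ^ 14)⁻¹ * (0.000058 * 2 ^ 14) := by norm_num
    rw [this, Real.log_mul (by norm_num) (by norm_num), Real.log_inv, Real.log_pow]
    have := Real.one_sub_inv_le_log_of_pos (show (0 : ℝ) < 0.000058 * 2 ^ 14 by norm_num)
    norm_num at this h2 ⊢
    linarith
  have e3 : (0.999971 : ℝ) ^ 2 ≤ β ^ 2 := by gcongr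
  have e4 : 2.774 * (0.999971 : ℝ) ^ 2 ≤ c * β ^ 2 := by gcongr
  norm_num at *
  linarith

lemma bad_bound (c β : ℝ) (hc : 2.774 < c) (hβ0 : 0.999971 < β) (n : ℕ) (hn : c ≤ n) :
    erProb n (c / n) (fun G => ¬ ∀ S : Finset (Fin n), ⌈β * n⌉₊ ≤ S.card →
          ¬ (G.induce (S : Set (Fin n))).Colorable 2) ≤
    Real.exp (n * (Real.log (2 + 0.000058) - 0.000029 * Real.log 0.000058 - c * β ^ 2 / 4)
      + c / 2) := by
  classical
  have hn0 : (0 : ℝ) < n := by linarith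
  have hp0 : 0 ≤ c / n := by apply div_nonneg <;> linarith
  have hp1 : c / n ≤ 1 := by rw [div_le_one hn0]; exact hn
  set m := ⌈β * n⌉₊ with hm
  have hmβ : β * n ≤ m := Nat.le_ceil _
  let s : Finset (Fin n → Option Bool) := Finset.univ.filter (fun f => removed n f + m ≤ n)
  have hlog : Real.log 0.000058 ≤ 0 := Real.log_nonpos (by norm_num) (by norm_num)
  have step1 := erProb_union s n (c / n) hp0 hp1 (fun G => ¬ ∀ S : Finset (Fin n), m ≤ S.card →
          ¬ (G.induce (S : Set (Fin n))).Colorable 2)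
          (fun f G => ∀ e ∈ monoPairs n f, e ∉ G.edgeSet) (by
    intro G hG
    push Not at hG
    obtain ⟨S, hS, hC⟩ := hG
    obtain ⟨f, hf, hf'⟩ := exists_coloring n m G S hS hC
    exact ⟨f, by simpa [s] using hf, hf'⟩)
  refine step1.trans ?_
  have step2 : ∀ f ∈ s, erProb n (c / n) (fun G => ∀ e ∈ monoPairs n f, e ∉ G.edgeSet) ≤
      (0.000058 : ℝ) ^ removed n f *
        Real.exp (n * (- 0.000029 * Real.log 0.000058 - c * β ^ 2 / 4) + c / 2) := by
    intro f hf
    have hr : removed n f + m ≤ n := by simpa [s] using hf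
    have hr' : (removed n f : ℝ) + m ≤ n := by exact_mod_cast hr
    rw [erProb_avoid]
    · have a1 : (1 - c / n) ^ (monoPairs n f).card ≤
          Real.exp (-(c / n) * (monoPairs n f).card) := by
        rw [mul_comm, Real.exp_nat_mul]
        have := Real.add_one_le_exp (-(c / n))
        apply pow_le_pow_left₀ <;> linarith
      refine a1.trans ?_
      have a2 : (0.000058 : ℝ) ^ removed n f = Real.exp (removed n f * Real.log 0.000058) := by
        rw [Real.exp_nat_mul, Real.exp_log (by norm_num)]
      rw [a2, ← Real.exp_add]
      apply Real.exp_le_exp.2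
      have a3 := monoPairs_card n f
      have a4 : (β * n) ^ 2 ≤ ((n : ℝ) - removed n f) ^ 2 := by
        have : 0 ≤ β * n := by apply mul_nonneg <;> linarith
        apply pow_le_pow_left₀ this
        linarith
      have a5 : (β * n) ^ 2 / 4 - (n : ℝ) / 2 ≤ (monoPairs n f).card := by linarith
      have a6 : c / n * ((β * n) ^ 2 / 4 - (n : ℝ) / 2) ≤ c / n * (monoPairs n f).card :=
        mul_le_mul_of_nonneg_left a5 hp0
      have a7 : c / n * ((β * n) ^ 2 / 4 - (n : ℝ) / 2) = n * (c * β ^ 2 / 4) - c / 2 := by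
        field_simp
      have a8 : (removed n f : ℝ) ≤ 0.000029 * n := by
        norm_num at hβ0 ⊢
        nlinarith
      have a9 := mul_le_mul_of_nonpos_right a8 hlog
      linarith
    · intro e he
      obtain ⟨u, v, huv, -, -, rfl⟩ := monoPairs_sub n f e he
      simpa using huv
  refine (Finset.sum_le_sum step2).trans ?_
  rw [← Finset.sum_mul]
  have step3 : ∑ f ∈ s, (0.000058 : ℝ) ^ removed n f ≤ (2 + 0.000058) ^ n := by
    rw [← sum_removed]
    exact Finset.sum_le_sum_of_subset_of_nonneg (Finset.subset_univ _)
      (fun _ _ _ => by positivity)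
  refine (mul_le_mul_of_nonneg_right step3 (Real.exp_pos _).le).trans ?_
  have a2 : (2 + 0.000058 : ℝ) ^ n = Real.exp (n * Real.log (2 + 0.000058)) := by
    rw [Real.exp_nat_mul, Real.exp_log (by norm_num)]
  rw [a2, ← Real.exp_add]
  apply Real.exp_le_exp.2
  apply le_of_eq
  ring

/-- For every real `c > 2.774` and every real `β` with `0.999971 < β ≤ 1`, w.h.p. the random
graph `G_{n,c/n}` contains no induced bipartite subgraph on `⌈βn⌉` or more vertices. -/
theorem statement12 (c β : ℝ) (hc : 2.774 < c) (hβ0 : 0.999971 < β) (hβ1 : β ≤ 1) :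
    Tendsto
      (fun n : ℕ => erProb n (c / n) (fun G =>
        ∀ S : Finset (Fin n), ⌈β * n⌉₊ ≤ S.card →
          ¬ (G.induce (S : Set (Fin n))).Colorable 2))
      atTop (nhds 1) := by
  have hr := rate_neg c β hc hβ0
  have hcn : ∀ᶠ n : ℕ in atTop, c ≤ n := tendsto_natCast_atTop_atTop.eventually_ge_atTop c
  have hlim : Tendsto (fun n : ℕ => Real.exp (n * (Real.log (2 + 0.000058)
      - 0.000029 * Real.log 0.000058 - c * β ^ 2 / 4) + c / 2)) atTop (nhds 0) := by
    apply Real.tendsto_exp_atBot.comp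
    apply tendsto_atBot_add_const_right
    exact tendsto_natCast_atTop_atTop.atTop_mul_const_of_neg hr
  have hbad : Tendsto (fun n : ℕ => erProb n (c / n) (fun G =>
      ¬ ∀ S : Finset (Fin n), ⌈β * n⌉₊ ≤ S.card →
          ¬ (G.induce (S : Set (Fin n))).Colorable 2)) atTop (nhds 0) := by
    refine tendsto_of_tendsto_of_tendsto_of_le_of_le' tendsto_const_nhds hlim ?_ ?_
    · filter_upwards [hcn] with n hn
      have hn0 : (0 : ℝ) < n := by linarith
      exact erProb_nonneg _ _ (by apply div_nonneg <;> linarith) (by rw [div_le_one hn0]; exact hn) _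
    · filter_upwards [hcn] with n hn
      exact bad_bound c β hc hβ0 n hn
  have := hbad.const_sub 1
  rw [sub_zero] at this
  refine this.congr fun n => ?_
  exact (erProb_add_not _ _ _).symm
end

section
/- Define, for real α_0, α_1, α_2, α_3 > 0 with α_4 := 1 − α_0 − α_1 − α_2 − α_3 > 0 and c = 4, b(c, α_0, α_1, α_2, α_3) = (∏_{i=0}^{4} α_i^{−α_i}) · e^{c(α_0 α_4 − 1/2)} · (e^{cα_0}−1)^{α_1} (e^{cα_1}−1)^{α_2} (e^{cα_2}−1)^{α_3} (e^{cα_3}−1)^{α_4} · (1 − e^{−α_3/α_2} e^{−cα_3})^{α_2}. Then for all (α_0, α_1, α_2, α_3) with α_i ≥ 0.06 for i = 0,1,2,3 and α_0 + α_1 + α_2 + α_3 ≤ 0.94, one has b(4, α_0, α_1, α_2, α_3) < 1. -/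
/-- The function `b(4, α₀, α₁, α₂, α₃)` from the first-moment bound for homomorphisms of
`G_{n,4/n}` to `C₅`, with `c = 4` and `α₄ = 1 - α₀ - α₁ - α₂ - α₃`. -/
noncomputable def bfun (a0 a1 a2 a3 : ℝ) : ℝ :=
  let c : ℝ := 4
  let a4 : ℝ := 1 - a0 - a1 - a2 - a3
  a0 ^ (-a0) * a1 ^ (-a1) * a2 ^ (-a2) * a3 ^ (-a3) * a4 ^ (-a4) *
    Real.exp (c * (a0 * a4 - 1 / 2)) *
    (Real.exp (c * a0) - 1) ^ a1 * (Real.exp (c * a1) - 1) ^ a2 *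
    (Real.exp (c * a2) - 1) ^ a3 * (Real.exp (c * a3) - 1) ^ a4 *
    (1 - Real.exp (-a3 / a2) * Real.exp (-c * a3)) ^ a2


/-! The proof bounds `log b` from above by tangent lines (entropy terms, `log (exp (4x) - 1)` and
`log (1 - exp (-y))` are all concave), which leaves a bilinear polynomial on each box, and then
runs a verified branch and bound over boxes, in integer arithmetic. -/

/-- lower bound for `log (j+1)` -/
def lgLo : ℕ → ℚ
  | 0 => 0
  | j + 1 => lgLo j + 2 * ∑ i ∈ Finset.range 5, (1 / (2 * (j : ℚ) + 3)) ^ (2 * i + 1) / (2 * i + 1)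

/-- upper bound for `log (j+1)` -/
def lgHi : ℕ → ℚ
  | 0 => 0
  | j + 1 => lgHi j + 2 * (∑ i ∈ Finset.range 5,
      (1 / (2 * (j : ℚ) + 3)) ^ (2 * i + 1) / (2 * i + 1) +
      (1 / (2 * (j : ℚ) + 3)) ^ (2 * 5 + 1) / (1 - (1 / (2 * (j : ℚ) + 3)) ^ 2))

lemma lg_step (j : ℕ) :
    Real.log ((j + 1 : ℕ) + 1) = Real.log (j + 1) +
      2 * (1 / 2 * Real.log ((1 + 1 / (2 * (j : ℝ) + 3)) / (1 - 1 / (2 * (j : ℝ) + 3)))) := by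
  have hj : (0 : ℝ) ≤ j := Nat.cast_nonneg j
  have : (1 + 1 / (2 * (j : ℝ) + 3)) / (1 - 1 / (2 * (j : ℝ) + 3)) = (j + 2) / (j + 1) := by
    have h3 : (2 * (j : ℝ) + 3) ≠ 0 := by positivity
    have h1 : (j : ℝ) + 1 ≠ 0 := by positivity
    have h2 : 1 - 1 / (2 * (j : ℝ) + 3) = 2 * (j + 1) / (2 * j + 3) := by field_simp; ring
    rw [h2]; field_simp; ring
  rw [this, Real.log_div (by positivity) (by positivity)]
  push_cast
  ring_nf

lemma lg_bounds (j : ℕ) :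
    (lgLo j : ℝ) ≤ Real.log (j + 1) ∧ Real.log (j + 1) ≤ (lgHi j : ℝ) := by
  induction j with
  | zero => simp [lgLo, lgHi]
  | succ j ih =>
    have hj : (0 : ℝ) ≤ j := Nat.cast_nonneg j
    have h0 : (0 : ℝ) ≤ 1 / (2 * (j : ℝ) + 3) := by positivity
    have h1 : 1 / (2 * (j : ℝ) + 3) < 1 := by
      rw [div_lt_one (by positivity)]; linarith
    have e1 := Real.sum_range_le_log_div h0 h1 5
    have e2 := Real.log_div_le_sum_range_add h0 h1 5
    rw [lg_step]
    simp only [lgLo, lgHi]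
    push_cast
    constructor
    · linarith [ih.1]
    · linarith [ih.2]

/-- A row: `k/32` is the tangent point for the entropy, `m/32` the parameter for
`log (exp (4x) - 1)`; the other entries are coefficients scaled by `1024`. -/
structure Row where
  k : ℕ
  m : ℕ
  P : ℤ
  E : ℤ
  A : ℤ
  B : ℤ

def table : List Row :=
  [⟨1, 28, 32, 2526, -3086, 32768⟩, ⟨2, 25, 64, 1816, -2458, 18725⟩, ⟨3, 22, 96, 1401, -2034, 13108⟩,
   ⟨4, 19, 128, 1106, -1702, 10083⟩, ⟨5, 17, 160, 878, -1509, 8739⟩, ⟨6, 15, 192, 691, -1332, 7711⟩,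
   ⟨7, 13, 224, 533, -1164, 6899⟩, ⟨8, 12, 256, 396, -1083, 6554⟩, ⟨9, 10, 288, 276, -924, 5958⟩,
   ⟨10, 9, 320, 168, -846, 5699⟩, ⟨11, 8, 352, 70, -767, 5462⟩, ⟨12, 7, 384, -19, -688, 5243⟩,
   ⟨13, 6, 416, -101, -607, 5042⟩, ⟨14, 6, 448, -177, -607, 5042⟩, ⟨15, 5, 480, -247, -525, 4855⟩,
   ⟨16, 4, 512, -314, -440, 4682⟩, ⟨17, 4, 544, -376, -440, 4682⟩, ⟨18, 3, 576, -434, -351, 4520⟩,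
   ⟨19, 3, 608, -489, -351, 4520⟩, ⟨20, 3, 640, -542, -351, 4520⟩, ⟨21, 2, 672, -592, -255, 4370⟩,
   ⟨22, 2, 704, -640, -255, 4370⟩, ⟨23, 2, 736, -685, -255, 4370⟩, ⟨24, 2, 768, -729, -255, 4370⟩,
   ⟨25, 1, 800, -771, -146, 4229⟩, ⟨26, 1, 832, -811, -146, 4229⟩]

def logOK (m : ℕ) (A : ℤ) : Bool :=
  decide (1 ≤ m) && decide (m ≤ 31) &&
  decide (1024 * ((lgHi (31 - m) - 5 * lgLo 1) * (32 - m) + m * (lgHi (m - 1) - 5 * lgLo 1))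
    ≤ (A : ℚ) * (32 - m))

def rowOK (r : Row) : Bool :=
  decide (1 ≤ r.k) && decide (1024 * (r.k : ℤ) ≤ 32 * r.P) &&
  decide (1024 * (5 * lgHi 1 - lgLo (r.k - 1)) - 1024 ≤ (r.E : ℚ)) &&
  logOK r.m r.A && decide (4096 * 32 ≤ r.B * (32 - r.m))

lemma table_ok : table.all rowOK = true := by decide +kernel

lemma tail_ok : logOK 6 (-607) = true := by decide +kernel

lemma lg_m (m : ℕ) (hm : 1 ≤ m) :
    (lgLo (m - 1) : ℝ) - 5 * lgHi 1 ≤ Real.log ((m : ℝ) / 32) ∧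
    Real.log ((m : ℝ) / 32) ≤ (lgHi (m - 1) : ℝ) - 5 * lgLo 1 := by
  obtain ⟨j, rfl⟩ : ∃ j, m = j + 1 := ⟨m - 1, by omega⟩
  have h := lg_bounds j
  have h2 := lg_bounds 1
  have e : Real.log (32 : ℝ) = 5 * Real.log (((1 : ℕ) : ℝ) + 1) := by
    rw [show (32 : ℝ) = (((1 : ℕ) : ℝ) + 1) ^ 5 by norm_num, Real.log_pow]; norm_num
  rw [Real.log_div (by positivity) (by norm_num), e]
  simp only [Nat.add_sub_cancel]
  push_cast at *
  constructor <;> linarith [h.1, h.2, h2.1, h2.2]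

/-- concave bound for `log (1 - exp (-y))` with rational parameter `u` -/
lemma log_one_sub_exp_le (u y : ℝ) (hu0 : 0 < u) (hu1 : u < 1) (hy : 0 < y) :
    (1 - u) * Real.log (1 - Real.exp (-y)) ≤ (1 - u) * Real.log (1 - u) + u * (y + Real.log u) := by
  have hz : 0 < 1 - Real.exp (-y) := by
    have := Real.exp_lt_one_iff.mpr (show -y < 0 by linarith)
    linarith
  have h1 : Real.exp (-y) ≥ u * (1 - y - Real.log u) := by
    have h := Real.add_one_le_exp (-y - Real.log u)
    rw [Real.exp_sub, Real.exp_log hu0, le_div_iff₀ hu0] at h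
    linarith
  have hu : 0 < 1 - u := by linarith
  have h2 := Real.log_le_sub_one_of_pos (div_pos hz hu)
  rw [Real.log_div hz.ne' hu.ne'] at h2
  have h3 : (1 - u) * ((1 - Real.exp (-y)) / (1 - u)) = 1 - Real.exp (-y) := by
    field_simp
  have h4 := mul_le_mul_of_nonneg_left h2 hu.le
  rw [mul_sub, mul_sub, h3] at h4
  linarith

lemma logOK_sound (m : ℕ) (A : ℤ) (h : logOK m A = true) (y : ℝ) (hy : 0 < y) :
    1 ≤ m ∧ m ≤ 31 ∧
    1024 * (32 - (m : ℝ)) * Real.log (1 - Real.exp (-y)) ≤ A * (32 - m) + 1024 * m * y := by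
  simp only [logOK, Bool.and_eq_true, decide_eq_true_eq] at h
  obtain ⟨⟨h1, h2⟩, h3⟩ := h
  refine ⟨h1, h2, ?_⟩
  have h3' : (1024 * (((lgHi (31 - m) : ℚ) - 5 * lgLo 1) * (32 - m) +
      m * (lgHi (m - 1) - 5 * lgLo 1)) : ℝ) ≤ (A : ℝ) * (32 - m) := by exact_mod_cast h3
  have hm1 : (1 : ℝ) ≤ m := by exact_mod_cast h1
  have hm2 : (m : ℝ) ≤ 31 := by exact_mod_cast h2
  have a1 := (lg_m m h1).2
  have a2 := (lg_m (32 - m) (by omega)).2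
  rw [show 32 - m - 1 = 31 - m by omega, Nat.cast_sub (by omega)] at a2
  have key := log_one_sub_exp_le ((m : ℝ) / 32) y (by positivity) (by linarith) hy
  rw [show (1 : ℝ) - m / 32 = (32 - m) / 32 by ring] at key
  push_cast at a2
  have b1 := mul_le_mul_of_nonneg_left a1 (show (0 : ℝ) ≤ m by linarith)
  have b2 := mul_le_mul_of_nonneg_left a2 (show (0 : ℝ) ≤ 32 - m by linarith)
  linarith

/-- validity of a row -/
structure Row.Valid (r : Row) : Prop where
  ent : ∀ x : ℝ, 0 < x → 1024 * (-(x * Real.log x)) ≤ r.P + r.E * x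
  phi : ∀ x : ℝ, 0 < x → 1024 * Real.log (Real.exp (4 * x) - 1) ≤ r.A + r.B * x

lemma row_valid (r : Row) (h : rowOK r = true) : r.Valid := by
  simp only [rowOK, Bool.and_eq_true, decide_eq_true_eq] at h
  obtain ⟨⟨⟨⟨h1, h2⟩, h3⟩, h4⟩, h5⟩ := h
  have hk : (1 : ℝ) ≤ r.k := by exact_mod_cast h1
  have h2' : 1024 * (r.k : ℝ) ≤ 32 * r.P := by exact_mod_cast h2
  have h3' : 1024 * (5 * (lgHi 1 : ℝ) - lgLo (r.k - 1)) - 1024 ≤ (r.E : ℝ) := by exact_mod_cast h3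
  have h5' : 4096 * 32 ≤ (r.B : ℝ) * (32 - r.m) := by exact_mod_cast h5
  constructor
  · intro x hx
    have hp : (0 : ℝ) < (r.k : ℝ) / 32 := by positivity
    have a := Real.log_le_sub_one_of_pos (div_pos hp hx)
    rw [Real.log_div hp.ne' hx.ne'] at a
    have a' := mul_le_mul_of_nonneg_left a hx.le
    rw [mul_sub, mul_sub, show x * ((r.k : ℝ) / 32 / x) = r.k / 32 by field_simp] at a'
    have b := mul_le_mul_of_nonneg_left (lg_m r.k h1).1 hx.le
    have c := mul_le_mul_of_nonneg_left h3' hx.le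
    linarith
  · intro x hx
    obtain ⟨m1, m2, hm⟩ := logOK_sound r.m r.A h4 (4 * x) (by linarith)
    have hm2 : (r.m : ℝ) ≤ 31 := by exact_mod_cast m2
    have e : Real.log (Real.exp (4 * x) - 1) = 4 * x + Real.log (1 - Real.exp (-(4 * x))) := by
      have hz : 0 < 1 - Real.exp (-(4 * x)) := by
        have := Real.exp_lt_one_iff.mpr (show -(4 * x) < 0 by linarith)
        linarith
      rw [show Real.exp (4 * x) - 1 = Real.exp (4 * x) * (1 - Real.exp (-(4 * x))) by
        rw [mul_sub, ← Real.exp_add]; simp, Real.log_mul (Real.exp_pos _).ne' hz.ne', Real.log_exp]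
    rw [e]
    have hpos : (0 : ℝ) < 32 - r.m := by linarith
    refine le_of_mul_le_mul_left ?_ hpos
    have c := mul_le_mul_of_nonneg_right h5' hx.le
    linarith

def row (c : ℤ) : Row := table.getD (((c + 8) / 16).toNat - 1) ⟨1, 28, 32, 2526, -3086, 32768⟩

lemma row_ok (c : ℤ) : (row c).Valid := by
  apply row_valid
  unfold row
  rcases lt_or_ge (((c + 8) / 16).toNat - 1) table.length with h | h
  · rw [List.getD_eq_getElem _ _ h]
    exact List.all_eq_true.mp table_ok _ (List.getElem_mem h)
  · rw [List.getD_eq_default _ _ h]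
    decide +kernel

/-- the bound on a box with centre `c` and half widths `h`, in units `1/512` -/
def chkAux (c0 c1 c2 c3 c4 h0 h1 h2 h3 : ℤ)
    (K l0 l1 l2 l3 l4 C0 C1 C2 C3 C4 : ℤ) : ℤ :=
  K * 262144 + 512 * (l0 * c0 + l1 * c1 + l2 * c2 + l3 * c3 + l4 * c4) +
  (C0 * c0 * c1 + C1 * c1 * c2 + C2 * c2 * c3 + C3 * c3 * c4 + C4 * c4 * c0) +
  |512 * (l0 - l4) + (C0 * c1 + C4 * c4) - (C3 * c3 + C4 * c0)| * h0 +
  |512 * (l1 - l4) + (C0 * c0 + C1 * c2) - (C3 * c3 + C4 * c0)| * h1 +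
  |512 * (l2 - l4) + (C1 * c1 + C2 * c3) - (C3 * c3 + C4 * c0)| * h2 +
  |512 * (l3 - l4) + (C2 * c2 + C3 * c4) - (C3 * c3 + C4 * c0)| * h3 +
  (|C0 - C4| * (h0 * h1) + |C4| * (h0 * h2) + |C4 + C3| * (h0 * h3) + |C1| * (h1 * h2) +
   |C3| * (h1 * h3) + |C2 - C3| * (h2 * h3))

def chkRows (c0 c1 c2 c3 c4 h0 h1 h2 h3 : ℤ) : Row → Row → Row → Row → Row → Bool
  | ⟨_, _, P0, E0, A0, B0⟩, ⟨_, _, P1, E1, A1, B1⟩, ⟨_, _, P2, E2, A2, B2⟩,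
    ⟨_, _, P3, E3, A3, B3⟩, ⟨_, _, P4, E4, _, _⟩ =>
    decide (0 ≤ B3) &&
    decide (chkAux c0 c1 c2 c3 c4 h0 h1 h2 h3 (P0 + P1 + P2 + P3 + P4 - 2048)
      E0 (E1 + A0) (E2 + A1 + (-607)) (E3 + A2 + 237) (E4 + A3) B0 B1 (B2 + 4 * 237) B3 4096 < 0)

def chk (c0 c1 c2 c3 h0 h1 h2 h3 : ℤ) : Bool :=
  chkRows c0 c1 c2 c3 (512 - c0 - c1 - c2 - c3) h0 h1 h2 h3
    (row c0) (row c1) (row c2) (row c3) (row (max 32 (512 - c0 - c1 - c2 - c3)))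

def run : ℕ → (c0 c1 c2 c3 h0 h1 h2 h3 : ℤ) → Bool
  | 0, _, _, _, _, _, _, _, _ => false
  | n + 1, c0, c1, c2, c3, h0, h1, h2, h3 =>
    decide (482 ≤ c0 + c1 + c2 + c3 - h0 - h1 - h2 - h3) ||
    (chk c0 c1 c2 c3 h0 h1 h2 h3 ||
    match n % 4 with
    | 0 => decide (h0 = 2 * (h0 / 2)) && run n (c0 - h0 / 2) c1 c2 c3 (h0 / 2) h1 h2 h3
        && run n (c0 + h0 / 2) c1 c2 c3 (h0 / 2) h1 h2 h3
    | 1 => decide (h1 = 2 * (h1 / 2)) && run n c0 (c1 - h1 / 2) c2 c3 h0 (h1 / 2) h2 h3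
        && run n c0 (c1 + h1 / 2) c2 c3 h0 (h1 / 2) h2 h3
    | 2 => decide (h2 = 2 * (h2 / 2)) && run n c0 c1 (c2 - h2 / 2) c3 h0 h1 (h2 / 2) h3
        && run n c0 c1 (c2 + h2 / 2) c3 h0 h1 (h2 / 2) h3
    | _ => decide (h3 = 2 * (h3 / 2)) && run n c0 c1 c2 (c3 - h3 / 2) h0 h1 h2 (h3 / 2)
        && run n c0 c1 c2 (c3 + h3 / 2) h0 h1 h2 (h3 / 2))

set_option maxRecDepth 100000 in
lemma run_ok : run 25 216 216 216 216 192 192 192 192 = true := by decide +kernel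

lemma mul_le_abs_mul (g d h : ℝ) (hd : |d| ≤ h) : g * d ≤ |g| * h :=
  (le_abs_self _).trans (by rw [abs_mul]; exact mul_le_mul_of_nonneg_left hd (abs_nonneg _))

lemma mul_mul_le_abs (g d e h k : ℝ) (hd : |d| ≤ h) (he : |e| ≤ k) :
    g * (d * e) ≤ |g| * (h * k) := by
  apply mul_le_abs_mul
  rw [abs_mul]
  exact mul_le_mul hd he (abs_nonneg _) ((abs_nonneg _).trans hd)

lemma chkAux_sound (c0 c1 c2 c3 c4 h0 h1 h2 h3 K l0 l1 l2 l3 l4 C0 C1 C2 C3 C4 : ℤ)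
    (x0 x1 x2 x3 x4 : ℝ) (hc : c4 = 512 - c0 - c1 - c2 - c3) (hx : x4 = 512 - x0 - x1 - x2 - x3)
    (hC3 : 0 ≤ C3) (hC4 : 0 ≤ C4)
    (d0 : |x0 - c0| ≤ h0) (d1 : |x1 - c1| ≤ h1) (d2 : |x2 - c2| ≤ h2) (d3 : |x3 - c3| ≤ h3) :
    (K : ℝ) * 262144 + 512 * (l0 * x0 + l1 * x1 + l2 * x2 + l3 * x3 + l4 * x4) +
      (C0 * x0 * x1 + C1 * x1 * x2 + C2 * x2 * x3 + C3 * x3 * x4 + C4 * x4 * x0) ≤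
    (chkAux c0 c1 c2 c3 c4 h0 h1 h2 h3 K l0 l1 l2 l3 l4 C0 C1 C2 C3 C4 : ℤ) := by
  have hc' : (c4 : ℝ) = 512 - c0 - c1 - c2 - c3 := by rw [hc]; push_cast; ring
  have hC3' : (0 : ℝ) ≤ C3 := by exact_mod_cast hC3
  have hC4' : (0 : ℝ) ≤ C4 := by exact_mod_cast hC4
  obtain ⟨e0, rfl⟩ : ∃ e, x0 = c0 + e := ⟨x0 - c0, by ring⟩
  obtain ⟨e1, rfl⟩ : ∃ e, x1 = c1 + e := ⟨x1 - c1, by ring⟩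
  obtain ⟨e2, rfl⟩ : ∃ e, x2 = c2 + e := ⟨x2 - c2, by ring⟩
  obtain ⟨e3, rfl⟩ : ∃ e, x3 = c3 + e := ⟨x3 - c3, by ring⟩
  simp only [add_sub_cancel_left] at d0 d1 d2 d3
  unfold chkAux
  push_cast
  have g0 := mul_le_abs_mul
    (512 * ((l0 : ℝ) - l4) + (C0 * c1 + C4 * c4) - (C3 * c3 + C4 * c0)) e0 h0 d0
  have g1 := mul_le_abs_mul
    (512 * ((l1 : ℝ) - l4) + (C0 * c0 + C1 * c2) - (C3 * c3 + C4 * c0)) e1 h1 d1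
  have g2 := mul_le_abs_mul
    (512 * ((l2 : ℝ) - l4) + (C1 * c1 + C2 * c3) - (C3 * c3 + C4 * c0)) e2 h2 d2
  have g3 := mul_le_abs_mul
    (512 * ((l3 : ℝ) - l4) + (C2 * c2 + C3 * c4) - (C3 * c3 + C4 * c0)) e3 h3 d3
  have q01 := mul_mul_le_abs ((C0 : ℝ) - C4) e0 e1 h0 h1 d0 d1
  have q02 := mul_mul_le_abs (C4 : ℝ) e0 (-e2) h0 h2 d0 (by rwa [abs_neg])
  have q03 := mul_mul_le_abs ((C4 : ℝ) + C3) e0 (-e3) h0 h3 d0 (by rwa [abs_neg])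
  have q12 := mul_mul_le_abs (C1 : ℝ) e1 e2 h1 h2 d1 d2
  have q13 := mul_mul_le_abs (C3 : ℝ) e1 (-e3) h1 h3 d1 (by rwa [abs_neg])
  have q23 := mul_mul_le_abs ((C2 : ℝ) - C3) e2 e3 h2 h3 d2 d3
  have s0 := mul_nonneg hC4' (sq_nonneg e0)
  have s3 := mul_nonneg hC3' (sq_nonneg e3)
  have hx' : x4 = c4 - e0 - e1 - e2 - e3 := by rw [hx, hc']; ring
  subst hx'
  refine le_trans (le_of_eq ?_) (add_le_add (add_le_add (add_le_add (add_le_add (add_le_add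
    (le_refl ((K : ℝ) * 262144 + 512 * (l0 * c0 + l1 * c1 + l2 * c2 + l3 * c3 + l4 * c4) +
      (C0 * c0 * c1 + C1 * c1 * c2 + C2 * c2 * c3 + C3 * c3 * c4 + C4 * c4 * c0)))
    g0) g1) g2) g3) (show ((C0 : ℝ) - C4) * (e0 * e1) + C4 * (e0 * (-e2)) +
      (C4 + C3) * (e0 * (-e3)) + C1 * (e1 * e2) + C3 * (e1 * (-e3)) + (C2 - C3) * (e2 * e3)
      - C4 * e0 ^ 2 - C3 * e3 ^ 2 ≤ _ by linarith))
  ring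

/-- the logarithm of `bfun` -/
noncomputable def lf (a0 a1 a2 a3 a4 : ℝ) : ℝ :=
  -(a0 * Real.log a0) + -(a1 * Real.log a1) + -(a2 * Real.log a2) + -(a3 * Real.log a3)
    + -(a4 * Real.log a4) + 4 * (a0 * a4 - 1 / 2)
    + a1 * Real.log (Real.exp (4 * a0) - 1) + a2 * Real.log (Real.exp (4 * a1) - 1)
    + a3 * Real.log (Real.exp (4 * a2) - 1) + a4 * Real.log (Real.exp (4 * a3) - 1)
    + a2 * Real.log (1 - Real.exp (-(a3 / a2 + 4 * a3)))

lemma chkRows_sound (c0 c1 c2 c3 c4 h0 h1 h2 h3 : ℤ) (r0 r1 r2 r3 r4 : Row)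
    (v0 : r0.Valid) (v1 : r1.Valid) (v2 : r2.Valid) (v3 : r3.Valid) (v4 : r4.Valid)
    (hc : c4 = 512 - c0 - c1 - c2 - c3)
    (h : chkRows c0 c1 c2 c3 c4 h0 h1 h2 h3 r0 r1 r2 r3 r4 = true)
    (a0 a1 a2 a3 a4 : ℝ) (p0 : 0 < a0) (p1 : 0 < a1) (p2 : 0 < a2) (p3 : 0 < a3) (p4 : 0 < a4)
    (hs : a4 = 1 - a0 - a1 - a2 - a3)
    (d0 : |512 * a0 - c0| ≤ h0) (d1 : |512 * a1 - c1| ≤ h1)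
    (d2 : |512 * a2 - c2| ≤ h2) (d3 : |512 * a3 - c3| ≤ h3) :
    lf a0 a1 a2 a3 a4 < 0 := by
  obtain ⟨_, _, P0, E0, A0, B0⟩ := r0
  obtain ⟨_, _, P1, E1, A1, B1⟩ := r1
  obtain ⟨_, _, P2, E2, A2, B2⟩ := r2
  obtain ⟨_, _, P3, E3, A3, B3⟩ := r3
  obtain ⟨_, _, P4, E4, A4, B4⟩ := r4
  simp only [chkRows, Bool.and_eq_true, decide_eq_true_eq] at h
  obtain ⟨hB3, h⟩ := h
  have key := chkAux_sound c0 c1 c2 c3 c4 h0 h1 h2 h3 (P0 + P1 + P2 + P3 + P4 - 2048)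
      E0 (E1 + A0) (E2 + A1 + (-607)) (E3 + A2 + 237) (E4 + A3) B0 B1 (B2 + 4 * 237) B3 4096
      (512 * a0) (512 * a1) (512 * a2) (512 * a3) (512 * a4) hc (by rw [hs]; ring) hB3 (by norm_num)
      d0 d1 d2 d3
  have h' : ((chkAux c0 c1 c2 c3 c4 h0 h1 h2 h3 (P0 + P1 + P2 + P3 + P4 - 2048)
      E0 (E1 + A0) (E2 + A1 + (-607)) (E3 + A2 + 237) (E4 + A3) B0 B1 (B2 + 4 * 237) B3 4096 : ℤ)
      : ℝ) < 0 := by exact_mod_cast h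
  have key2 := lt_of_le_of_lt key h'
  push_cast at key2
  have n0 := v0.ent a0 p0
  have n1 := v1.ent a1 p1
  have n2 := v2.ent a2 p2
  have n3 := v3.ent a3 p3
  have n4 := v4.ent a4 p4
  have f0 := mul_le_mul_of_nonneg_left (v0.phi a0 p0) p1.le
  have f1 := mul_le_mul_of_nonneg_left (v1.phi a1 p1) p2.le
  have f2 := mul_le_mul_of_nonneg_left (v2.phi a2 p2) p3.le
  have f3 := mul_le_mul_of_nonneg_left (v3.phi a3 p3) p4.le
  have t := mul_le_mul_of_nonneg_left
    (logOK_sound 6 _ tail_ok (a3 / a2 + 4 * a3) (by positivity)).2.2 p2.le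
  have t2 : a2 * (a3 / a2) = a3 := by field_simp
  have t3 : 1024 * (a2 * Real.log (1 - Real.exp (-(a3 / a2 + 4 * a3)))) ≤
      -607 * a2 + 237 * (a3 + 4 * (a2 * a3)) := by
    have q : 0 < a2 * a3 := mul_pos p2 p3
    have e : a2 * (1024 * 6 * (a3 / a2 + 4 * a3)) = 1024 * 6 * (a3 + 4 * (a2 * a3)) := by
      rw [← t2]; field_simp
    push_cast at t
    rw [mul_add, e] at t
    linarith
  dsimp only at n0 n1 n2 n3 n4 f0 f1 f2 f3
  unfold lf
  linarith

lemma run_sound (n : ℕ) : ∀ (c0 c1 c2 c3 h0 h1 h2 h3 : ℤ)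
    (_ : run n c0 c1 c2 c3 h0 h1 h2 h3 = true)
    (a0 a1 a2 a3 a4 : ℝ) (_ : 0 < a0) (_ : 0 < a1) (_ : 0 < a2) (_ : 0 < a3)
    (_ : 0.06 ≤ a4) (_ : a4 = 1 - a0 - a1 - a2 - a3)
    (_ : |512 * a0 - c0| ≤ h0) (_ : |512 * a1 - c1| ≤ h1)
    (_ : |512 * a2 - c2| ≤ h2) (_ : |512 * a3 - c3| ≤ h3),
    lf a0 a1 a2 a3 a4 < 0 := by
  have split : ∀ (x : ℝ) (c h : ℤ), h = 2 * (h / 2) → |x - c| ≤ h →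
      |x - ((c - h / 2 : ℤ) : ℝ)| ≤ ((h / 2 : ℤ) : ℝ) ∨
      |x - ((c + h / 2 : ℤ) : ℝ)| ≤ ((h / 2 : ℤ) : ℝ) := by
    intro x c h hh hx
    have hh' : (h : ℝ) = 2 * ((h / 2 : ℤ) : ℝ) := by exact_mod_cast hh
    rw [hh'] at hx
    push_cast
    obtain ⟨u, v⟩ := abs_le.mp hx
    rcases le_total x c with hc | hc
    · left; rw [abs_le]; constructor <;> linarith
    · right; rw [abs_le]; constructor <;> linarith
  induction n with
  | zero => intro c0 c1 c2 c3 h0 h1 h2 h3 h; simp [run] at h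
  | succ n ih =>
    intro c0 c1 c2 c3 h0 h1 h2 h3 h a0 a1 a2 a3 a4 p0 p1 p2 p3 p4 hs d0 d1 d2 d3
    rw [run, Bool.or_eq_true, Bool.or_eq_true, decide_eq_true_eq] at h
    rcases h with h | h | h
    · exfalso
      have h' : (482 : ℝ) ≤ c0 + c1 + c2 + c3 - h0 - h1 - h2 - h3 := by exact_mod_cast h
      have := (abs_le.mp d0).1
      have := (abs_le.mp d1).1
      have := (abs_le.mp d2).1
      have := (abs_le.mp d3).1
      norm_num at p4
      linarith
    · exact chkRows_sound c0 c1 c2 c3 _ h0 h1 h2 h3 _ _ _ _ _ (row_ok _) (row_ok _) (row_ok _)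
        (row_ok _) (row_ok _) rfl h a0 a1 a2 a3 a4 p0 p1 p2 p3 (by norm_num at p4; linarith) hs
        d0 d1 d2 d3
    · split at h <;> rw [Bool.and_eq_true, Bool.and_eq_true, decide_eq_true_eq] at h <;>
        obtain ⟨⟨hh, ha⟩, hb⟩ := h
      · rcases split _ _ _ hh d0 with d | d
        · exact ih _ _ _ _ _ _ _ _ ha a0 a1 a2 a3 a4 p0 p1 p2 p3 p4 hs d d1 d2 d3
        · exact ih _ _ _ _ _ _ _ _ hb a0 a1 a2 a3 a4 p0 p1 p2 p3 p4 hs d d1 d2 d3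
      · rcases split _ _ _ hh d1 with d | d
        · exact ih _ _ _ _ _ _ _ _ ha a0 a1 a2 a3 a4 p0 p1 p2 p3 p4 hs d0 d d2 d3
        · exact ih _ _ _ _ _ _ _ _ hb a0 a1 a2 a3 a4 p0 p1 p2 p3 p4 hs d0 d d2 d3
      · rcases split _ _ _ hh d2 with d | d
        · exact ih _ _ _ _ _ _ _ _ ha a0 a1 a2 a3 a4 p0 p1 p2 p3 p4 hs d0 d1 d d3
        · exact ih _ _ _ _ _ _ _ _ hb a0 a1 a2 a3 a4 p0 p1 p2 p3 p4 hs d0 d1 d d3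
      · rcases split _ _ _ hh d3 with d | d
        · exact ih _ _ _ _ _ _ _ _ ha a0 a1 a2 a3 a4 p0 p1 p2 p3 p4 hs d0 d1 d2 d
        · exact ih _ _ _ _ _ _ _ _ hb a0 a1 a2 a3 a4 p0 p1 p2 p3 p4 hs d0 d1 d2 d

lemma exp_sub_one_pos {x : ℝ} (hx : 0 < x) : 0 < Real.exp (4 * x) - 1 := by
  have := Real.one_lt_exp_iff.mpr (show 0 < 4 * x by linarith)
  linarith

/-- For all `(α₀, α₁, α₂, α₃)` with each `αᵢ ≥ 0.06` and `α₀ + α₁ + α₂ + α₃ ≤ 0.94`,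
one has `b(4, α₀, α₁, α₂, α₃) < 1`. -/
theorem statement17 (a0 a1 a2 a3 : ℝ)
    (h0 : 0.06 ≤ a0) (h1 : 0.06 ≤ a1) (h2 : 0.06 ≤ a2) (h3 : 0.06 ≤ a3)
    (hsum : a0 + a1 + a2 + a3 ≤ 0.94) :
    bfun a0 a1 a2 a3 < 1 := by
  norm_num at h0 h1 h2 h3 hsum
  have p0 : 0 < a0 := by linarith
  have p1 : 0 < a1 := by linarith
  have p2 : 0 < a2 := by linarith
  have p3 : 0 < a3 := by linarith
  obtain ⟨a4, ha4⟩ : ∃ a4, a4 = 1 - a0 - a1 - a2 - a3 := ⟨_, rfl⟩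
  have p4 : 0 < a4 := by linarith
  have key : lf a0 a1 a2 a3 a4 < 0 := by
    refine run_sound 25 _ _ _ _ _ _ _ _ run_ok a0 a1 a2 a3 a4 p0 p1 p2 p3
      (by norm_num; linarith) ha4 ?_ ?_ ?_ ?_ <;>
    · push_cast
      rw [abs_le]; constructor <;> linarith
  have hz : 0 < 1 - Real.exp (-(a3 / a2 + 4 * a3)) := by
    have : 0 < a3 / a2 := div_pos p3 p2
    have := Real.exp_lt_one_iff.mpr (show -(a3 / a2 + 4 * a3) < 0 by linarith)
    linarith
  have he : Real.exp (-a3 / a2) * Real.exp (-4 * a3) = Real.exp (-(a3 / a2 + 4 * a3)) := by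
    rw [← Real.exp_add]; congr 1; ring
  have hb : bfun a0 a1 a2 a3 = Real.exp (lf a0 a1 a2 a3 a4) := by
    unfold bfun lf
    simp only [← ha4]
    rw [he, Real.rpow_def_of_pos p0, Real.rpow_def_of_pos p1, Real.rpow_def_of_pos p2,
      Real.rpow_def_of_pos p3, Real.rpow_def_of_pos p4, Real.rpow_def_of_pos (exp_sub_one_pos p0),
      Real.rpow_def_of_pos (exp_sub_one_pos p1), Real.rpow_def_of_pos (exp_sub_one_pos p2),
      Real.rpow_def_of_pos (exp_sub_one_pos p3), Real.rpow_def_of_pos hz]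
    simp only [← Real.exp_add]
    congr 1
    ring
  rw [hb]
  exact Real.exp_lt_one_iff.mpr key
end
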